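/- In U, if n = 1 (so that α_1 is odd and isotropic), then ⟦⟦χ_1⁺, χ_2⁺⟧, ⟦χ_1⁺, χ_0⁺⟧⟧ = ⟦χ_1⁺, ⟦χ_2⁺, ⟦χ_1⁺, χ_0⁺⟧⟧⟧. -/

import Mathlib

noncomputable section

open Finset

/-- The base field `K = ℂ(v)`, with `v = q^{1/2}`. -/
abbrev KK : Type := RatFunc ℂ

/-- The variable `v = q^{1/2}`; thus `q^{a} = vv ^ (2*a)`. -/
def vv : KK := RatFunc.X

/-- `(ε_{k+1}, ε_{k+1})` for `0 ≤ k < N` (0-indexed). -/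
def epsSq (n k : ℕ) : ℤ := if k < n then -1 else 1

/-- coefficient of `ε_{k+1}` (0-indexed `k`) in the simple root `α_i`, `0 ≤ i ≤ m+n`. -/
def co (m n i k : ℕ) : ℤ :=
  if i = 0 then (if k = 0 then -2 else 0)
  else if i = m + n then (if k + 1 = m + n then 1 else 0)
  else (if k + 1 = i then 1 else 0) - (if k = i then 1 else 0)

/-- `(α_i, α_j)`. -/
def Bmat (m n i j : ℕ) : ℤ :=
  ∑ k ∈ Finset.range (m + n), epsSq n k * co m n i k * co m n j k

/-- Bilinear form on weights written in the `α`-basis (coords `ℕ → ℤ`). -/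
def Bw (m n : ℕ) (a b : ℕ → ℤ) : ℤ :=
  ∑ i ∈ Finset.range (m + n + 1), ∑ j ∈ Finset.range (m + n + 1), a i * b j * Bmat m n i j

/-- the weight `α_i` in `α`-coordinates. -/
def uw (i : ℕ) : ℕ → ℤ := fun j => if j = i then 1 else 0

/-- the sign `(-1)^{[a][b]}`: the parity of a weight `a` is `a n mod 2`. -/
def sg (n : ℕ) (a b : ℕ → ℤ) : KK := (-1 : KK) ^ (a n * b n)

/-- the coefficient `(-1)^{[a][b]} q^{-(a,b)}` appearing in `⟦·,·⟧`. -/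
def qcf (m n : ℕ) (a b : ℕ → ℤ) : KK := sg n a b * vv ^ (-2 * Bw m n a b)

/-- `q_i = vv ^ qexp i`. -/
def qexp (m n i : ℕ) : ℤ := if Bmat m n i i = 0 then 2 else |Bmat m n i i|

/-- the quantum integer `[a]_i`. -/
def qint (m n i : ℕ) (a : ℤ) : KK :=
  (vv ^ (qexp m n i * a) - vv ^ (-(qexp m n i * a))) / (vv ^ qexp m n i - vv ^ (-qexp m n i))

/-- the matrix `A_{ij}`. -/
def Amat (m n i j : ℕ) : ℤ := if i = m + n then 2 * Bmat m n i j else Bmat m n i j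

section brackets
variable {A : Type*} [Ring A] [Algebra KK A]

/-- `[x, y]_c = x y - c • (y x)`. -/
def cbr (c : KK) (x y : A) : A := x * y - c • (y * x)

/-- supercommutator of homogeneous elements of weights `a`, `b`. -/
def sbr (n : ℕ) (a b : ℕ → ℤ) (x y : A) : A := cbr (sg n a b) x y

/-- the bracket `⟦x, y⟧` for homogeneous elements of weights `a`, `b`. -/
def qbr (m n : ℕ) (a b : ℕ → ℤ) (x y : A) : A := cbr (qcf m n a b) x y

end brackets

/-- total weight of a list of simple-root indices. -/
def lwt (l : List ℕ) : ℕ → ℤ := l.foldr (fun j w => uw j + w) 0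

/-- right-nested `⟦·,⟦·,…⟧⟧` of a list of simple root vectors `e j`. -/
def qfoldr (m n : ℕ) {A : Type*} [Ring A] [Algebra KK A] (e : ℕ → A) : List ℕ → A
  | [] => 1
  | [j] => e j
  | j :: rest => qbr m n (uw j) (lwt rest) (e j) (qfoldr m n e rest)

/-! ## The Drinfeld–Jimbo presentation `U = U_q[osp(2m+1|2n)^{(1)}]` -/

/-- Generators of `U`. -/
inductive UGen (m n : ℕ) : Type
  | cp (i : Fin (m + n + 1))   -- χ_i⁺
  | cm (i : Fin (m + n + 1))   -- χ_i⁻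
  | kk (i : Fin (m + n + 1))   -- K_i
  | ki (i : Fin (m + n + 1))   -- K_i⁻¹
  | kd                          -- K_δ^{1/2}
  | kdi                         -- K_δ^{-1/2}

/-- Free algebra on the generators of `U`. -/
abbrev UF (m n : ℕ) : Type := FreeAlgebra KK (UGen m n)

def uidx (m n : ℕ) (i : ℕ) : Fin (m + n + 1) := ⟨i % (m + n + 1), Nat.mod_lt _ (Nat.succ_pos _)⟩

def fcp (m n : ℕ) (i : ℕ) : UF m n := FreeAlgebra.ι KK (UGen.cp (uidx m n i))
def fcm (m n : ℕ) (i : ℕ) : UF m n := FreeAlgebra.ι KK (UGen.cm (uidx m n i))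
def fk (m n : ℕ) (i : ℕ) : UF m n := FreeAlgebra.ι KK (UGen.kk (uidx m n i))
def fki (m n : ℕ) (i : ℕ) : UF m n := FreeAlgebra.ι KK (UGen.ki (uidx m n i))
def fkd (m n : ℕ) : UF m n := FreeAlgebra.ι KK (UGen.kd)
def fkdi (m n : ℕ) : UF m n := FreeAlgebra.ι KK (UGen.kdi)
/-- `χ_i^σ`, `σ = true` for `+`. -/
def fx (m n : ℕ) (σ : Bool) (i : ℕ) : UF m n := if σ then fcp m n i else fcm m n i

/-- left-hand side of DJ9. -/
def dj9lhs (m n : ℕ) (σ : Bool) : UF m n :=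
  sbr n (uw 3 + uw 2 + uw 1 + uw 0 + uw 1 + uw 2) (uw 1)
   (qbr m n (uw 3 + uw 2 + uw 1 + uw 0 + uw 1) (uw 2)
    (qbr m n (uw 3 + uw 2 + uw 1 + uw 0) (uw 1)
     (qbr m n (uw 3 + uw 2 + uw 1) (uw 0)
      (qbr m n (uw 3 + uw 2) (uw 1)
       (qbr m n (uw 3) (uw 2) (fx m n σ 3) (fx m n σ 2))
       (fx m n σ 1))
      (fx m n σ 0))
     (fx m n σ 1))
    (fx m n σ 2))
   (fx m n σ 1)

/-- `⟦χ_2^σ, χ_1^σ⟧`. -/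
def dj10A (m n : ℕ) (σ : Bool) : UF m n := qbr m n (uw 2) (uw 1) (fx m n σ 2) (fx m n σ 1)

/-- left-hand side of DJ10. -/
def dj10lhs (m n : ℕ) (σ : Bool) : UF m n :=
  qbr m n (uw 2 + uw 1) ((uw 2 + uw 1) + ((uw 2 + uw 1) + uw 0)) (dj10A m n σ)
   (qbr m n (uw 2 + uw 1) ((uw 2 + uw 1) + uw 0) (dj10A m n σ)
    (qbr m n (uw 2 + uw 1) (uw 0) (dj10A m n σ) (fx m n σ 0)))

/-- right-hand side of DJ10 (without the scalar). -/
def dj10rhs (m n : ℕ) (σ : Bool) : UF m n :=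
  qbr m n ((uw 2 + uw 1) + (uw 2 + (uw 2 + (uw 1 + uw 0)))) (uw 1)
   (qbr m n (uw 2 + uw 1) (uw 2 + (uw 2 + (uw 1 + uw 0))) (dj10A m n σ)
    (qbr m n (uw 2) (uw 2 + (uw 1 + uw 0)) (fx m n σ 2)
     (qbr m n (uw 2) (uw 1 + uw 0) (fx m n σ 2)
      (qbr m n (uw 1) (uw 0) (fx m n σ 1) (fx m n σ 0)))))
   (fx m n σ 1)

/-- The defining relations (DJ1)–(DJ11) of `U_q[osp(2m+1|2n)^{(1)}]`. -/
inductive URel (m n : ℕ) : UF m n → UF m n → Prop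
  | k_inv (i : ℕ) (hi : i ≤ m + n) : URel m n (fk m n i * fki m n i) 1
  | inv_k (i : ℕ) (hi : i ≤ m + n) : URel m n (fki m n i * fk m n i) 1
  | k_k (i j : ℕ) (hi : i ≤ m + n) (hj : j ≤ m + n) :
      URel m n (fk m n i * fk m n j) (fk m n j * fk m n i)
  | k_x (σ : Bool) (i j : ℕ) (hi : i ≤ m + n) (hj : j ≤ m + n) :
      URel m n (fk m n i * fx m n σ j * fki m n i)
           ((vv ^ ((if σ then 2 else -2) * Bmat m n i j)) • fx m n σ j)
  | xp_xm (i j : ℕ) (hi : i ≤ m + n) (hj : j ≤ m + n) :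
      URel m n (sbr n (uw i) (uw j) (fcp m n i) (fcm m n j))
           (if i = j then (vv ^ qexp m n i - vv ^ (-qexp m n i))⁻¹ • (fk m n i - fki m n i) else 0)
  | x_x (σ : Bool) (i j : ℕ) (hi : i ≤ m + n) (hj : j ≤ m + n) (h0 : Bmat m n i j = 0) :
      URel m n (sbr n (uw i) (uw j) (fx m n σ i) (fx m n σ j)) 0
  | serre_up (σ : Bool) (i : ℕ) (hi : i < m + n) (hn : i ≠ n) :
      URel m n (qbr m n (uw i) (uw i + uw (i+1)) (fx m n σ i)
             (qbr m n (uw i) (uw (i+1)) (fx m n σ i) (fx m n σ (i+1)))) 0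
  | serre_dn (σ : Bool) (i : ℕ) (h1 : 1 < i) (hi : i < m + n) (hn : i ≠ n) :
      URel m n (qbr m n (uw i) (uw i + uw (i-1)) (fx m n σ i)
             (qbr m n (uw i) (uw (i-1)) (fx m n σ i) (fx m n σ (i-1)))) 0
  | serre3 (σ : Bool) (i : ℕ) (hi : i = 1 ∨ i = m + n) :
      URel m n (qbr m n (uw i) (uw i + (uw i + uw (i-1))) (fx m n σ i)
             (qbr m n (uw i) (uw i + uw (i-1)) (fx m n σ i)
               (qbr m n (uw i) (uw (i-1)) (fx m n σ i) (fx m n σ (i-1))))) 0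
  | serre4 (σ : Bool) (hn : 1 < n) :
      URel m n (sbr n (uw (n-1) + uw n + uw (n+1)) (uw n)
             (qbr m n (uw (n-1) + uw n) (uw (n+1))
               (qbr m n (uw (n-1)) (uw n) (fx m n σ (n-1)) (fx m n σ n)) (fx m n σ (n+1)))
             (fx m n σ n)) 0
  | serre5 (σ : Bool) (hn : n = 1) (hm : 2 ≤ m) : URel m n (dj9lhs m n σ) 0
  | serre6 (σ : Bool) (hn : n = 1) (hm : m = 1) :
      URel m n (dj10lhs m n σ) ((1 - qint m n 1 2) • dj10rhs m n σ)
  | kd_inv : URel m n (fkd m n * fkdi m n) 1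
  | inv_kd : URel m n (fkdi m n * fkd m n) 1
  | kd_sq : URel m n (fkd m n * fkd m n)
      (fk m n 0 * ((List.range (m + n)).map (fun i => fk m n (i+1) * fk m n (i+1))).prod)
  | kd_c (y : UGen m n) : URel m n (fkd m n * FreeAlgebra.ι KK y) (FreeAlgebra.ι KK y * fkd m n)
  | kdi_c (y : UGen m n) : URel m n (fkdi m n * FreeAlgebra.ι KK y) (FreeAlgebra.ι KK y * fkdi m n)

/-- The Drinfeld–Jimbo quantum affine superalgebra `U_q[osp(2m+1|2n)^{(1)}]`. -/
abbrev UAlg (m n : ℕ) : Type := RingQuot (URel m n)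

def mkU (m n : ℕ) : UF m n →ₐ[KK] UAlg m n := RingQuot.mkAlgHom KK (URel m n)

def cp (m n : ℕ) (i : ℕ) : UAlg m n := mkU m n (fcp m n i)
def cm (m n : ℕ) (i : ℕ) : UAlg m n := mkU m n (fcm m n i)
def kU (m n : ℕ) (i : ℕ) : UAlg m n := mkU m n (fk m n i)
def kiU (m n : ℕ) (i : ℕ) : UAlg m n := mkU m n (fki m n i)
def kdU (m n : ℕ) : UAlg m n := mkU m n (fkd m n)
def kdiU (m n : ℕ) : UAlg m n := mkU m n (fkdi m n)


theorem Bw_add_left (m n : ℕ) (a b c : ℕ → ℤ) :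
    Bw m n (a + b) c = Bw m n a c + Bw m n b c := by
  simp only [Bw, Pi.add_apply, add_mul, Finset.sum_add_distrib]

theorem Bw_add_right (m n : ℕ) (a b c : ℕ → ℤ) :
    Bw m n a (b + c) = Bw m n a b + Bw m n a c := by
  simp only [Bw, Pi.add_apply, mul_add, add_mul, Finset.sum_add_distrib]

theorem Bw_uw_uw (m n i j : ℕ) (hi : i ≤ m + n) (hj : j ≤ m + n) :
    Bw m n (uw i) (uw j) = Bmat m n i j := by
  simp [Bw, uw, Nat.lt_succ_of_le hi, Nat.lt_succ_of_le hj]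

theorem Bmat_one_one (k : ℕ) : Bmat (k + 1) 1 1 1 = 0 := by
  simp [Bmat, Finset.sum_range_succ', co, epsSq]

theorem Bmat_one_zero (k : ℕ) : Bmat (k + 1) 1 1 0 = 2 := by
  simp [Bmat, co, epsSq]

theorem Bmat_two_zero (k : ℕ) : Bmat (k + 1) 1 2 0 = 0 := by
  simp [Bmat, co, epsSq]

theorem Bmat_one_two (k : ℕ) : Bmat (k + 1) 1 1 2 = -1 := by
  cases k <;> simp [Bmat, Finset.sum_range_succ', co, epsSq]

theorem Bmat_two_one (k : ℕ) : Bmat (k + 1) 1 2 1 = -1 := by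
  cases k <;> simp [Bmat, Finset.sum_range_succ', co, epsSq]

theorem vv_ne_zero : vv ≠ 0 := RatFunc.X_ne_zero

/-- The odd isotropic root vector `χ_1⁺` squares to zero. -/
theorem cp_one_mul_cp_one (k : ℕ) : cp (k + 1) 1 1 * cp (k + 1) 1 1 = 0 := by
  have h := RingQuot.mkAlgHom_rel KK
    (URel.x_x (m := k + 1) (n := 1) true 1 1 (by omega) (by omega) (Bmat_one_one k))
  change mkU (k + 1) 1 _ = mkU (k + 1) 1 _ at h
  have h2 : cp (k + 1) 1 1 * cp (k + 1) 1 1 + cp (k + 1) 1 1 * cp (k + 1) 1 1 = 0 := by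
    simpa [sbr, cbr, sg, uw, fx, cp] using h
  rw [← two_smul KK] at h2
  exact (smul_eq_zero.mp h2).resolve_left two_ne_zero

/-- Rearrangement of twisted commutators of `x`, `y`, `z` with `x * x = 0`. -/
theorem twisted_commutator_rearrange {F A : Type*} [Field F] [Ring A] [Algebra F A] {q : F}
    (hq : q ≠ 0) {x : A} (hx : x * x = 0) (y z : A) :
    (x * y - q • (y * x)) * (x * z - (q⁻¹ * q⁻¹) • (z * x))
        - (-q⁻¹) • ((x * z - (q⁻¹ * q⁻¹) • (z * x)) * (x * y - q • (y * x)))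
      = x * (y * (x * z - (q⁻¹ * q⁻¹) • (z * x)) - q • ((x * z - (q⁻¹ * q⁻¹) • (z * x)) * y))
        - (-q⁻¹) • ((y * (x * z - (q⁻¹ * q⁻¹) • (z * x))
            - q • ((x * z - (q⁻¹ * q⁻¹) • (z * x)) * y)) * x) := by
  have hx' (w : A) : x * (x * w) = 0 := by rw [← mul_assoc, hx, zero_mul]
  simp only [mul_sub, sub_mul, smul_sub, mul_smul_comm, smul_mul_assoc, smul_smul,
    mul_assoc, hx, hx', mul_zero, smul_zero]
  match_scalars <;> field_simp

/-- in `U`, if `n = 1` (so that `α_1` is odd isotropic), then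
`⟦⟦χ_1⁺, χ_2⁺⟧, ⟦χ_1⁺, χ_0⁺⟧⟧ = ⟦χ_1⁺, ⟦χ_2⁺, ⟦χ_1⁺, χ_0⁺⟧⟧⟧`. -/
theorem bracket_rearrangement_of_n_eq_one
    (m n : ℕ) (hm : 1 ≤ m) (hn : n = 1) :
    qbr m n (uw 1 + uw 2) (uw 1 + uw 0)
      (qbr m n (uw 1) (uw 2) (cp m n 1) (cp m n 2))
      (qbr m n (uw 1) (uw 0) (cp m n 1) (cp m n 0))
    = qbr m n (uw 1) (uw 2 + (uw 1 + uw 0)) (cp m n 1)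
        (qbr m n (uw 2) (uw 1 + uw 0) (cp m n 2)
          (qbr m n (uw 1) (uw 0) (cp m n 1) (cp m n 0))) := by
  obtain ⟨k, rfl⟩ : ∃ k, m = k + 1 := ⟨m - 1, by omega⟩
  subst hn
  have h11 := (Bw_uw_uw (k + 1) 1 1 1 (by omega) (by omega)).trans (Bmat_one_one k)
  have h10 := (Bw_uw_uw (k + 1) 1 1 0 (by omega) (by omega)).trans (Bmat_one_zero k)
  have h20 := (Bw_uw_uw (k + 1) 1 2 0 (by omega) (by omega)).trans (Bmat_two_zero k)
  have h12 := (Bw_uw_uw (k + 1) 1 1 2 (by omega) (by omega)).trans (Bmat_one_two k)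
  have h21 := (Bw_uw_uw (k + 1) 1 2 1 (by omega) (by omega)).trans (Bmat_two_one k)
  have c12 : qcf (k + 1) 1 (uw 1) (uw 2) = vv ^ 2 := by
    simp only [qcf, h12]
    simp [sg, uw]
  have c10 : qcf (k + 1) 1 (uw 1) (uw 0) = (vv ^ 2)⁻¹ * (vv ^ 2)⁻¹ := by
    simp only [qcf, h10]
    simp [sg, uw]
    rw [← mul_inv, ← pow_add, ← zpow_natCast, ← zpow_neg]
  have c2 : qcf (k + 1) 1 (uw 2) (uw 1 + uw 0) = vv ^ 2 := by
    simp only [qcf, Bw_add_right, h21, h20]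
    simp [sg, uw]
  have c1 : qcf (k + 1) 1 (uw 1) (uw 2 + (uw 1 + uw 0)) = -(vv ^ 2)⁻¹ := by
    simp only [qcf, Bw_add_right, h12, h11, h10]
    simp [sg, uw]
  have c : qcf (k + 1) 1 (uw 1 + uw 2) (uw 1 + uw 0) = -(vv ^ 2)⁻¹ := by
    simp only [qcf, Bw_add_right, Bw_add_left, h11, h10, h21, h20]
    simp [sg, uw]
  simp only [qbr, c12, c10, c2, c1, c]
  exact twisted_commutator_rearrange (pow_ne_zero 2 vv_ne_zero) (cp_one_mul_cp_one k) _ _
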